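/- Fix n ≥ 1 and 1 ≤ p ≤ ∞, and let D_p(t) = (1/n)[E_{h∼N(0,I_n)} dist(h, {x : ‖x‖_{p*} ≤ t})]². The function D_p is infinitely differentiable on (0,∞); define g(t) = D_p(t) − (t/2)D_p'(t). Then for any 0 < δ < D_p(0) there exists a unique t* ∈ (0,∞) such that g(t) > δ for t < t* and g(t) < δ for t > t*; moreover g(t*) = δ and D_p(t*) < δ. -/

import Mathlib

open MeasureTheory ProbabilityTheory Filter
open scoped ENNReal NNReal

/-- The standard Gaussian measure `N(0, I_n)` on `ℝ^n`. -/
noncomputable def stdGaussian (n : ℕ) : Measure (Fin n → ℝ) :=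
  Measure.pi fun _ => gaussianReal 0 1

/-- The Euclidean (`ℓ²`) norm on `ℝ^n`. -/
noncomputable def l2norm {n : ℕ} (x : Fin n → ℝ) : ℝ := Real.sqrt (∑ i, x i ^ 2)

/-- The `ℓ^q` norm on `ℝ^n` for an extended exponent `q ∈ [1, ∞]`. -/
noncomputable def lqNorm {n : ℕ} (q : ℝ≥0∞) (x : Fin n → ℝ) : ℝ :=
  if q = ⊤ then ⨆ i, |x i| else (∑ i, |x i| ^ q.toReal) ^ (1 / q.toReal)

/-- Euclidean distance from `h ∈ ℝ^n` to a set `C ⊆ ℝ^n`. -/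
noncomputable def distL2 {n : ℕ} (C : Set (Fin n → ℝ)) (h : Fin n → ℝ) : ℝ :=
  sInf ((fun w => l2norm (h - w)) '' C)

/-- `D_p(t; n) = (1/n) (E_{h ∼ N(0,I_n)} dist(h, {x : ‖x‖_{p*} ≤ t}))²`, expressed in terms
of the Hölder conjugate exponent `q = p*`. -/
noncomputable def Dp (q : ℝ≥0∞) (n : ℕ) (t : ℝ) : ℝ :=
  (1 / n) * (∫ h, distL2 {x | lqNorm q x ≤ t} h ∂stdGaussian n) ^ 2

section
open Set Topology

theorem ConvexOn.strictAntiOn_of_tendsto_zero {F : ℝ → ℝ} (hc : ConvexOn ℝ (Ici 0) F)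
    (hpos : ∀ t, 0 ≤ t → 0 < F t) (hlim : Tendsto F atTop (𝓝 0)) :
    StrictAntiOn F (Ici 0) := by
  intro s hs t ht hst
  by_contra! hle
  have key : ∀ u, t < u → F t ≤ F u := by
    intro u hu
    have hu0 : u ∈ Ici (0 : ℝ) := le_trans (mem_Ici.1 ht) hu.le
    have := hc.slope_mono_adjacent hs hu0 hst hu
    have h1 : 0 ≤ (F t - F s) / (t - s) := div_nonneg (by linarith) (by linarith)
    have h2 : 0 ≤ (F u - F t) / (u - t) := h1.trans this
    have h3 := (div_nonneg_iff.1 h2).resolve_right (by rintro ⟨-, h⟩; linarith)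
    linarith [h3.1]
  have : F t ≤ 0 := ge_of_tendsto hlim (eventually_atTop.2 ⟨t + 1, fun u hu => key u (by linarith)⟩)
  linarith [hpos t ht]

theorem ConvexOn.antitoneOn_tangent_intercept {F : ℝ → ℝ} (hc : ConvexOn ℝ (Ici 0) F)
    (hd : ∀ t, 0 < t → DifferentiableAt ℝ F t) :
    AntitoneOn (fun t => F t - t * deriv F t) (Ioi 0) := by
  intro s hs t ht hst
  rcases hst.eq_or_lt with rfl | hst
  · rfl
  have hs' : 0 < s := hs
  have ht' : 0 < t := ht
  have h1 := hc.deriv_le_slope (mem_Ici.2 hs'.le) (mem_Ici.2 ht'.le) hst (hd s hs)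
  have h2 := hc.slope_le_deriv (mem_Ici.2 hs'.le) (mem_Ici.2 ht'.le) hst (hd t ht)
  have h3 := mul_le_mul_of_nonneg_left (h1.trans h2) hs'.le
  rw [slope_def_field, div_le_iff₀ (by linarith)] at h2
  dsimp only
  nlinarith

/-- The threshold property for the square of a positive convex function on `[0, ∞)` that
vanishes at infinity. -/
theorem exists_threshold_of_convexOn {F : ℝ → ℝ} {c K : ℝ} (hcpos : 0 < c)
    (hc : ConvexOn ℝ (Ici 0) F) (hpos : ∀ t, 0 ≤ t → 0 < F t) (hlim : Tendsto F atTop (𝓝 0))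
    (hzero : ∀ t, 0 ≤ t → F 0 - K * t ≤ F t) (hsm : ContDiffOn ℝ (⊤ : ℕ∞) F (Ioi 0))
    {D : ℝ → ℝ} (hD : ∀ t, D t = c * F t ^ 2) {δ : ℝ} (hδ : 0 < δ) (hδ0 : δ < D 0) :
    ∃ tstar : ℝ, 0 < tstar ∧
      (∀ t : ℝ, 0 < t → t < tstar → δ < D t - (t / 2) * deriv D t) ∧
      (∀ t : ℝ, tstar < t → D t - (t / 2) * deriv D t < δ) ∧
      D tstar - (tstar / 2) * deriv D tstar = δ ∧
      D tstar < δ ∧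
      (∀ s : ℝ, 0 < s →
        (∀ t : ℝ, 0 < t → t < s → δ < D t - (t / 2) * deriv D t) →
        (∀ t : ℝ, s < t → D t - (t / 2) * deriv D t < δ) → s = tstar) := by
  have hd : ∀ t, 0 < t → DifferentiableAt ℝ F t := fun t ht =>
    (hsm.differentiableOn (by simp)).differentiableAt (Ioi_mem_nhds ht)
  have hanti := hc.strictAntiOn_of_tendsto_zero hpos hlim
  have hintg := hc.antitoneOn_tangent_intercept hd
  have hderiv : ∀ t, 0 < t → deriv F t < 0 := by
    intro t ht
    have h1 := hc.deriv_le_slope (mem_Ici.2 ht.le) (y := t + 1) (mem_Ici.2 (by linarith))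
      (by linarith) (hd t ht)
    have h2 := hanti (mem_Ici.2 ht.le) (mem_Ici.2 (by linarith : (0 : ℝ) ≤ t + 1)) (by linarith)
    rw [slope_def_field] at h1
    norm_num at h1
    linarith
  have hI0 : ∀ t, 0 < t → F t - t * deriv F t ≤ F 0 := by
    intro t ht
    have h1 := hc.slope_le_deriv (mem_Ici.2 le_rfl) (mem_Ici.2 ht.le) ht (hd t ht)
    rw [slope_def_field, div_le_iff₀ (by linarith)] at h1
    linarith
  have hIpos : ∀ t, 0 < t → F t < F t - t * deriv F t := fun t ht => by
    nlinarith [mul_pos ht (neg_pos.2 (hderiv t ht))]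
  set g : ℝ → ℝ := fun t => c * F t * (F t - t * deriv F t) with hg
  have hgD : ∀ t, 0 < t → D t - (t / 2) * deriv D t = g t := by
    intro t ht
    have : D = fun t => c * F t ^ 2 := funext hD
    have h1 : HasDerivAt D (c * (2 * F t * deriv F t)) t := by
      rw [this]
      simpa using ((hd t ht).hasDerivAt.pow 2).const_mul c
    rw [h1.deriv, hD, hg]
    ring
  have hganti : StrictAntiOn g (Ioi 0) := by
    intro s hs t ht hst
    have hs' : 0 < s := hs
    have ht' : 0 < t := ht
    have h1 := hanti (mem_Ici.2 hs'.le) (mem_Ici.2 ht'.le) hst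
    have h2 : F t - t * deriv F t ≤ F s - s * deriv F s := hintg hs ht hst.le
    have h3 := (hpos t ht'.le).trans (hIpos t ht)
    have h4 := hpos t ht'.le
    calc g t < c * F s * (F t - t * deriv F t) := by
          simp only [hg]; gcongr
      _ ≤ g s := by
          have := hpos s hs'.le
          simp only [hg]; gcongr
  have hgcont : ContinuousOn g (Ioi 0) := by
    have h1 : ContinuousOn (deriv F) (Ioi 0) :=
      hsm.continuousOn_deriv_of_isOpen isOpen_Ioi (by simp)
    have h2 := hsm.continuousOn
    simp only [hg]
    fun_prop
  have hsmall : ∃ a, 0 < a ∧ δ < g a := by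
    have h1 : Tendsto (fun t => c * (F 0 - K * t) ^ 2) (𝓝 0) (𝓝 (c * (F 0 - K * 0) ^ 2)) :=
      Continuous.tendsto (by fun_prop) 0
    have h2 : ∀ᶠ t in 𝓝 (0 : ℝ), δ < c * (F 0 - K * t) ^ 2 :=
      h1.eventually (lt_mem_nhds (by rw [hD] at hδ0; simpa using hδ0))
    have h3 : ∀ᶠ t in 𝓝 (0 : ℝ), 0 < F 0 - K * t :=
      (Continuous.tendsto (f := fun t => F 0 - K * t) (by fun_prop) 0).eventually
        (lt_mem_nhds (by simpa using hpos 0 le_rfl))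
    obtain ⟨a, ⟨ha2, ha3⟩, ha⟩ := (((h2.and h3).filter_mono nhdsWithin_le_nhds).and
      (self_mem_nhdsWithin : Ioi (0 : ℝ) ∈ 𝓝[>] 0)).exists
    have ha' : 0 < a := ha
    refine ⟨a, ha, ha2.trans_le ?_⟩
    have h4 := hzero a ha'.le
    have h5 := (hIpos a ha').le
    have h6 := hpos a ha'.le
    calc c * (F 0 - K * a) ^ 2 = c * (F 0 - K * a) * (F 0 - K * a) := by ring
      _ ≤ c * F a * (F a - a * deriv F a) := by
        exact mul_le_mul (mul_le_mul_of_nonneg_left h4 hcpos.le) (h4.trans h5) ha3.le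
          (by positivity)
  have hlarge : ∃ b, 0 < b ∧ g b < δ := by
    have h1 : Tendsto (fun t => c * F t * F 0) atTop (𝓝 (c * 0 * F 0)) :=
      (hlim.const_mul c).mul_const _
    obtain ⟨b, hb, hb0⟩ := ((h1.eventually (gt_mem_nhds (by simpa using hδ))).and
      (eventually_gt_atTop 0)).exists
    refine ⟨b, hb0, lt_of_le_of_lt ?_ hb⟩
    have := hpos b hb0.le
    simp only [hg]
    gcongr
    exact hI0 b hb0
  obtain ⟨a, ha, hga⟩ := hsmall
  obtain ⟨b, hb, hgb⟩ := hlarge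
  obtain ⟨τ, hτ, hgτ⟩ : δ ∈ g '' Ioi 0 :=
    isPreconnected_Ioi.intermediate_value hb ha hgcont ⟨hgb.le, hga.le⟩
  have hτ' : 0 < τ := hτ
  have hleft : ∀ t : ℝ, 0 < t → t < τ → δ < D t - (t / 2) * deriv D t := fun t ht htτ => by
    rw [hgD t ht, ← hgτ]; exact hganti ht hτ htτ
  have hright : ∀ t : ℝ, τ < t → D t - (t / 2) * deriv D t < δ := fun t ht => by
    rw [hgD t (hτ'.trans ht), ← hgτ]; exact hganti hτ (hτ'.trans ht) ht
  refine ⟨τ, hτ', hleft, hright, by rw [hgD τ hτ', hgτ], ?_, fun s hs h1 h2 => ?_⟩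
  · rw [hD, ← hgτ, pow_two, ← mul_assoc]
    have := hpos τ hτ'.le
    exact mul_lt_mul_of_pos_left (hIpos τ hτ') (by positivity)
  · rcases lt_trichotomy s τ with h | h | h
    · obtain ⟨m, hm1, hm2⟩ := exists_between h
      exact absurd (h2 m hm1) (hleft m (hs.trans hm1) hm2).not_gt
    · exact h
    · obtain ⟨m, hm1, hm2⟩ := exists_between h
      exact absurd (hright m hm1) (h1 m (hτ'.trans hm1) hm2).not_gt
end

section
open Set

theorem integrable_gaussianReal_id : Integrable (fun x : ℝ => x) (gaussianReal 0 1) :=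
  (memLp_id_gaussianReal 1).integrable le_rfl

instance isProbabilityMeasure_stdGaussian_pi (n : ℕ) : IsProbabilityMeasure (stdGaussian n) := by
  unfold _root_.stdGaussian; infer_instance

instance isOpenPosMeasure_stdGaussian_pi (n : ℕ) :
    (stdGaussian n).IsOpenPosMeasure := by
  have : (gaussianReal 0 1).IsOpenPosMeasure :=
    (gaussianReal_absolutelyContinuous' 0 one_ne_zero).isOpenPosMeasure
  unfold _root_.stdGaussian; infer_instance

theorem pi_gaussianReal_eq_withDensity {ι : Type*} [Fintype ι] (m : ℝ) {v : ℝ≥0} (hv : v ≠ 0) :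
    Measure.pi (fun _ : ι => gaussianReal m v) =
      volume.withDensity (fun x => ENNReal.ofReal (∏ i, gaussianPDFReal m v (x i))) := by
  refine (Measure.pi_eq fun s hs => ?_)
  rw [withDensity_apply _ (MeasurableSet.univ_pi hs), ← ofReal_integral_eq_lintegral_ofReal]
  · rw [volume_pi, Measure.restrict_pi_pi,
      integral_fintype_prod_eq_prod (f := fun _ => gaussianPDFReal m v),
      ENNReal.ofReal_prod_of_nonneg]
    · exact Finset.prod_congr rfl fun i _ => (gaussianReal_apply_eq_integral m hv (s i)).symm
    · exact fun i _ => integral_nonneg fun x => gaussianPDFReal_nonneg m v x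
  · exact (Integrable.fintype_prod fun _ => integrable_gaussianPDFReal m v).restrict
  · exact ae_of_all _ fun x => Finset.prod_nonneg fun i _ => gaussianPDFReal_nonneg m v (x i)

theorem stdGaussian_map_inv_smul (n : ℕ) {t : ℝ} (ht : 0 < t) :
    (stdGaussian n).map (fun h => t⁻¹ • h) =
      volume.withDensity (fun x => ENNReal.ofReal
        ((t / √(2 * Real.pi)) ^ n * Real.exp (t ^ 2 / 2 * -∑ i, x i ^ 2))) := by
  have h1 : (stdGaussian n).map (fun h => t⁻¹ • h) =
      Measure.pi (fun _ : Fin n => gaussianReal 0 (.mk (t⁻¹ ^ 2) (sq_nonneg _))) := by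
    have := Measure.pi_map_pi (μ := fun _ : Fin n => gaussianReal 0 1)
      (f := fun _ x => t⁻¹ * x) (hμ := fun i => by
        rw [gaussianReal_map_const_mul]; infer_instance) (fun i => by fun_prop)
    simp only [gaussianReal_map_const_mul, mul_zero, mul_one] at this
    exact this
  rw [h1, pi_gaussianReal_eq_withDensity]
  · congr 1
    ext x
    congr 1
    simp only [gaussianPDFReal_def, Finset.prod_mul_distrib, ← Real.exp_sum]
    congr 1
    · simp only [NNReal.coe_mk, Finset.prod_const, Finset.card_univ, Fintype.card_fin]
      congr 1
      rw [Real.sqrt_mul (by positivity), Real.sqrt_sq (by positivity)]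
      field_simp
    · rw [← Finset.sum_neg_distrib, Finset.mul_sum]
      congr 1
      refine Finset.sum_congr rfl fun i _ => ?_
      simp only [NNReal.coe_mk]
      field_simp
      ring
  · rw [Ne, ← NNReal.coe_eq_zero]
    simp [ht.ne']

theorem contDiffOn_integral_inv_smul_stdGaussian {n : ℕ} {d : (Fin n → ℝ) → ℝ}
    (hd : Continuous d) (hd0 : ∀ x, 0 ≤ d x)
    (hintg : ∀ t : ℝ, 0 < t → Integrable (fun h => d (t⁻¹ • h)) (stdGaussian n)) :
    ContDiffOn ℝ (⊤ : ℕ∞) (fun t : ℝ => ∫ h, d (t⁻¹ • h) ∂stdGaussian n) (Ioi 0) := by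
  set X : (Fin n → ℝ) → ℝ := fun x => -∑ i, x i ^ 2 with hX
  set ν : Measure (Fin n → ℝ) := volume.withDensity (fun x => ENNReal.ofReal (d x)) with hν
  have hcpos : ∀ t : ℝ, 0 < t → 0 < (t / √(2 * Real.pi)) ^ n := fun t ht => by positivity
  have hXm : Continuous X := by fun_prop
  have hset : Ioi (0 : ℝ) ⊆ integrableExpSet X ν := by
    intro s hs
    have hs' : 0 < s := hs
    have h1 := hintg (√(2 * s)) (by positivity)
    have h2 : Integrable d ((stdGaussian n).map (fun h => (√(2 * s))⁻¹ • h)) :=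
      (integrable_map_measure hd.aestronglyMeasurable (by fun_prop)).2 h1
    rw [stdGaussian_map_inv_smul n (by positivity), integrable_withDensity_iff (by fun_prop)
      (ae_of_all _ fun _ => ENNReal.ofReal_lt_top)] at h2
    simp only [integrableExpSet, mem_ofPred_eq]
    rw [hν, integrable_withDensity_iff (by fun_prop) (ae_of_all _ fun _ => ENNReal.ofReal_lt_top)]
    have hc := hcpos (√(2 * s)) (by positivity)
    refine (h2.const_mul ((√(2 * s) / √(2 * Real.pi)) ^ n)⁻¹).congr (ae_of_all _ fun x => ?_)
    dsimp only
    rw [ENNReal.toReal_ofReal (by positivity), ENNReal.toReal_ofReal (hd0 x),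
      Real.sq_sqrt (by positivity), mul_div_cancel_left₀ _ (two_ne_zero)]
    simp only [hX]
    field_simp
  have heq : ∀ t ∈ Ioi (0 : ℝ), ∫ h, d (t⁻¹ • h) ∂stdGaussian n =
      (t / √(2 * Real.pi)) ^ n * mgf X ν (t ^ 2 / 2) := by
    intro t ht
    have ht' : 0 < t := ht
    rw [← integral_map (f := d) (φ := fun h => t⁻¹ • h) (by fun_prop) hd.aestronglyMeasurable,
      stdGaussian_map_inv_smul n ht', mgf, hν,
      integral_withDensity_eq_integral_toReal_smul (by fun_prop)
        (ae_of_all _ fun _ => ENNReal.ofReal_lt_top),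
      integral_withDensity_eq_integral_toReal_smul (by fun_prop)
        (ae_of_all _ fun _ => ENNReal.ofReal_lt_top), ← integral_const_mul]
    refine integral_congr_ae (ae_of_all _ fun x => ?_)
    dsimp only
    rw [ENNReal.toReal_ofReal (by positivity), ENNReal.toReal_ofReal (hd0 x), smul_eq_mul,
      smul_eq_mul]
    ring
  refine ContDiffOn.congr ?_ heq
  have hmgf : ContDiffOn ℝ (⊤ : ℕ∞) (mgf X ν) (Ioi 0) :=
    (analyticOnNhd_mgf.mono (interior_maximal hset isOpen_Ioi)).contDiffOn (uniqueDiffOn_Ioi 0)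
  refine ContDiffOn.mul (by fun_prop) (hmgf.comp (by fun_prop) fun t ht => ?_)
  have ht' : 0 < t := ht
  exact mem_Ioi.2 (by positivity)
end

section
open Set Topology

theorem l2norm_eq_norm {n : ℕ} (x : Fin n → ℝ) :
    l2norm x = ‖(WithLp.toLp 2 x : EuclideanSpace ℝ (Fin n))‖ := by
  simp [l2norm, EuclideanSpace.norm_eq]

theorem l2norm_nonneg {n : ℕ} (x : Fin n → ℝ) : 0 ≤ l2norm x := Real.sqrt_nonneg _

theorem l2norm_add_le {n : ℕ} (x y : Fin n → ℝ) : l2norm (x + y) ≤ l2norm x + l2norm y := by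
  simp only [l2norm_eq_norm, WithLp.toLp_add]
  exact norm_add_le _ _

theorem l2norm_smul {n : ℕ} (a : ℝ) (x : Fin n → ℝ) : l2norm (a • x) = |a| * l2norm x := by
  simp only [l2norm_eq_norm, WithLp.toLp_smul, norm_smul, Real.norm_eq_abs]

theorem l2norm_le_sum_abs {n : ℕ} (x : Fin n → ℝ) : l2norm x ≤ ∑ i, |x i| := by
  refine Real.sqrt_le_iff.2 ⟨Finset.sum_nonneg fun i _ => abs_nonneg _, ?_⟩
  simpa only [sq_abs] using
    Finset.sum_sq_le_sq_sum_of_nonneg (s := Finset.univ) (f := fun i => |x i|)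
      fun i _ => abs_nonneg (x i)

theorem continuous_l2norm {n : ℕ} : Continuous (l2norm : (Fin n → ℝ) → ℝ) := by
  unfold l2norm; fun_prop

theorem distL2_eq_infDist {n : ℕ} (C : Set (Fin n → ℝ)) (h : Fin n → ℝ) :
    distL2 C h = Metric.infDist (WithLp.toLp 2 h : EuclideanSpace ℝ (Fin n))
      (WithLp.toLp 2 '' C) := by
  rw [Metric.infDist_eq_iInf, ← sInf_image' (f := fun y => dist (WithLp.toLp 2 h) y), distL2,
    image_image]
  simp only [l2norm_eq_norm, dist_eq_norm, WithLp.toLp_sub]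

theorem continuous_distL2 {n : ℕ} (C : Set (Fin n → ℝ)) : Continuous (distL2 C) := by
  have : distL2 C = fun h => Metric.infDist (WithLp.toLp 2 h : EuclideanSpace ℝ (Fin n))
      (WithLp.toLp 2 '' C) := funext (distL2_eq_infDist C)
  rw [this]
  exact (Metric.continuous_infDist_pt _).comp (PiLp.continuous_toLp 2 _)

theorem distL2_nonneg {n : ℕ} (C : Set (Fin n → ℝ)) (h : Fin n → ℝ) : 0 ≤ distL2 C h := by
  rw [distL2_eq_infDist]; exact Metric.infDist_nonneg

theorem distL2_le {n : ℕ} {C : Set (Fin n → ℝ)} {w : Fin n → ℝ} (hw : w ∈ C) (h : Fin n → ℝ) :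
    distL2 C h ≤ l2norm (h - w) :=
  csInf_le ⟨0, by rintro _ ⟨v, -, rfl⟩; exact l2norm_nonneg _⟩ ⟨w, hw, rfl⟩

theorem le_distL2 {n : ℕ} {C : Set (Fin n → ℝ)} (hC : C.Nonempty) {h : Fin n → ℝ} {r : ℝ}
    (H : ∀ w ∈ C, r ≤ l2norm (h - w)) : r ≤ distL2 C h :=
  le_csInf (hC.image _) (by rintro _ ⟨w, hw, rfl⟩; exact H w hw)

theorem exists_lt_of_distL2_lt {n : ℕ} {C : Set (Fin n → ℝ)} (hC : C.Nonempty) {h : Fin n → ℝ}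
    {r : ℝ} (H : distL2 C h < r) : ∃ w ∈ C, l2norm (h - w) < r := by
  obtain ⟨_, ⟨w, hw, rfl⟩, hlt⟩ := exists_lt_of_csInf_lt (hC.image _) H
  exact ⟨w, hw, hlt⟩

variable {n : ℕ} (N : Seminorm ℝ (Fin n → ℝ))

theorem Seminorm.zero_mem_sublevel {t : ℝ} (ht : 0 ≤ t) :
    (0 : Fin n → ℝ) ∈ {x | N x ≤ t} := by
  simpa using ht

theorem distL2_sublevel_le_l2norm {t : ℝ} (ht : 0 ≤ t) (h : Fin n → ℝ) :
    distL2 {x | N x ≤ t} h ≤ l2norm h := by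
  simpa using distL2_le (N.zero_mem_sublevel ht) h

theorem distL2_sublevel_eq_zero {t : ℝ} {h : Fin n → ℝ} (ht : N h ≤ t) :
    distL2 {x | N x ≤ t} h = 0 := by
  refine le_antisymm ?_ (distL2_nonneg _ _)
  simpa [l2norm] using distL2_le (C := {x | N x ≤ t}) ht h

theorem le_distL2_sublevel {K : ℝ} (hK0 : 0 ≤ K) (hK : ∀ x, l2norm x ≤ K * N x) {t : ℝ}
    (ht : 0 ≤ t) (h : Fin n → ℝ) : l2norm h - K * t ≤ distL2 {x | N x ≤ t} h := by
  refine le_distL2 ⟨0, N.zero_mem_sublevel ht⟩ fun w hw => ?_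
  have h1 : N w ≤ t := hw
  have h2 := l2norm_add_le (h - w) w
  rw [sub_add_cancel] at h2
  have h3 := hK w
  have h4 := mul_le_mul_of_nonneg_left h1 hK0
  linarith

theorem distL2_sublevel_eq_mul {t : ℝ} (ht : 0 < t) (h : Fin n → ℝ) :
    distL2 {x | N x ≤ t} h = t * distL2 {x | N x ≤ 1} (t⁻¹ • h) := by
  apply le_antisymm
  · rw [← div_le_iff₀' ht]
    refine le_distL2 ⟨0, N.zero_mem_sublevel zero_le_one⟩ fun w hw => ?_
    have hw' : N w ≤ 1 := hw
    have hmem : t • w ∈ {x | N x ≤ t} := by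
      have := mul_le_mul_of_nonneg_left hw' ht.le
      simpa [map_smul_eq_mul, abs_of_pos ht] using this
    rw [div_le_iff₀' ht]
    refine (distL2_le hmem h).trans_eq ?_
    rw [show h - t • w = t • (t⁻¹ • h - w) by rw [smul_sub, smul_inv_smul₀ ht.ne'],
      l2norm_smul, abs_of_pos ht]
  · refine le_distL2 ⟨0, N.zero_mem_sublevel ht.le⟩ fun w hw => ?_
    have hw' : N w ≤ t := hw
    have hmem : t⁻¹ • w ∈ {x | N x ≤ 1} := by
      simpa [map_smul_eq_mul, abs_of_pos ht, inv_mul_le_iff₀ ht] using hw'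
    have := mul_le_mul_of_nonneg_left (distL2_le hmem (t⁻¹ • h)) ht.le
    rwa [← smul_sub, l2norm_smul, abs_of_pos (inv_pos.2 ht), mul_inv_cancel_left₀ ht.ne'] at this

theorem convexOn_distL2_sublevel (h : Fin n → ℝ) :
    ConvexOn ℝ (Ici 0) (fun t => distL2 {x | N x ≤ t} h) := by
  refine ⟨convex_Ici 0, fun s hs t ht a b ha hb hab => ?_⟩
  simp only [smul_eq_mul]
  refine le_of_forall_pos_le_add fun ε hε => ?_
  obtain ⟨v, hv, hv'⟩ := exists_lt_of_distL2_lt ⟨0, N.zero_mem_sublevel (mem_Ici.1 hs)⟩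
    (lt_add_of_pos_right (distL2 {x | N x ≤ s} h) hε)
  obtain ⟨w, hw, hw'⟩ := exists_lt_of_distL2_lt ⟨0, N.zero_mem_sublevel (mem_Ici.1 ht)⟩
    (lt_add_of_pos_right (distL2 {x | N x ≤ t} h) hε)
  have hv1 : N v ≤ s := hv
  have hw1 : N w ≤ t := hw
  have hmem : a • v + b • w ∈ {x | N x ≤ a * s + b * t} := by
    refine (map_add_le_add N _ _).trans ?_
    rw [map_smul_eq_mul, map_smul_eq_mul, Real.norm_of_nonneg ha, Real.norm_of_nonneg hb]
    gcongr
  have heq : h - (a • v + b • w) = a • (h - v) + b • (h - w) := by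
    have : h = a • h + b • h := by rw [← add_smul, hab, one_smul]
    nth_rewrite 1 [this]
    module
  have h1 := distL2_le hmem h
  have h2 := l2norm_add_le (a • (h - v)) (b • (h - w))
  rw [l2norm_smul, l2norm_smul, abs_of_nonneg ha, abs_of_nonneg hb] at h2
  rw [heq] at h1
  have h3 := mul_le_mul_of_nonneg_left hv'.le ha
  have h4 := mul_le_mul_of_nonneg_left hw'.le hb
  have h5 : a * ε + b * ε = ε := by rw [← add_mul, hab, one_mul]
  linarith

theorem integrable_l2norm (n : ℕ) :
    Integrable (l2norm : (Fin n → ℝ) → ℝ) (stdGaussian n) := by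
  have h1 : Integrable (fun x : Fin n → ℝ => ∑ i, |x i|) (stdGaussian n) :=
    integrable_finsetSum _ fun i _ => by
      have := integrable_comp_eval (μ := fun _ : Fin n => gaussianReal 0 1) (i := i)
        integrable_gaussianReal_id.abs
      exact this
  refine h1.mono' continuous_l2norm.aestronglyMeasurable (ae_of_all _ fun x => ?_)
  rw [Real.norm_of_nonneg (l2norm_nonneg x)]
  exact l2norm_le_sum_abs x

theorem integrable_distL2_sublevel {t : ℝ} (ht : 0 ≤ t) :
    Integrable (distL2 {x | N x ≤ t}) (stdGaussian n) := by
  refine (integrable_l2norm n).mono' (continuous_distL2 _).aestronglyMeasurable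
    (ae_of_all _ fun x => ?_)
  rw [Real.norm_of_nonneg (distL2_nonneg _ x)]
  exact distL2_sublevel_le_l2norm N ht x

/-- The expected Euclidean distance of a standard Gaussian vector to the ball of radius `t` of a
seminorm. -/
noncomputable def gaussianMeanDist (t : ℝ) : ℝ :=
  ∫ h, distL2 {x | N x ≤ t} h ∂stdGaussian n

theorem convexOn_gaussianMeanDist : ConvexOn ℝ (Ici 0) (gaussianMeanDist N) := by
  refine ⟨convex_Ici 0, fun s hs t ht a b ha hb hab => ?_⟩
  have hs' : 0 ≤ s := hs
  have ht' : 0 ≤ t := ht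
  simp only [gaussianMeanDist, smul_eq_mul]
  rw [← integral_const_mul, ← integral_const_mul, ← integral_add
    ((integrable_distL2_sublevel N hs').const_mul a) ((integrable_distL2_sublevel N ht').const_mul b)]
  refine integral_mono (integrable_distL2_sublevel N (by positivity))
    (((integrable_distL2_sublevel N hs').const_mul a).add
      ((integrable_distL2_sublevel N ht').const_mul b)) fun h => ?_
  simpa using (convexOn_distL2_sublevel N h).2 hs ht ha hb hab

theorem gaussianMeanDist_zero_sub_le {K : ℝ} (hK0 : 0 ≤ K) (hK : ∀ x, l2norm x ≤ K * N x) {t : ℝ}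
    (ht : 0 ≤ t) : gaussianMeanDist N 0 - K * t ≤ gaussianMeanDist N t := by
  have h1 : ∫ h, (distL2 {x | N x ≤ 0} h - K * t) ∂stdGaussian n =
      gaussianMeanDist N 0 - K * t := by
    rw [integral_sub (integrable_distL2_sublevel N le_rfl) (integrable_const _)]
    simp [gaussianMeanDist]
  rw [← h1]
  refine integral_mono ((integrable_distL2_sublevel N le_rfl).sub (integrable_const _))
    (integrable_distL2_sublevel N ht) fun h => ?_
  have h2 := le_distL2_sublevel N hK0 hK ht h
  have h3 := distL2_sublevel_le_l2norm N le_rfl h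
  dsimp only
  linarith

theorem gaussianMeanDist_pos [NeZero n] {K : ℝ} (hK0 : 0 ≤ K) (hK : ∀ x, l2norm x ≤ K * N x)
    {t : ℝ} (ht : 0 ≤ t) : 0 < gaussianMeanDist N t := by
  rw [gaussianMeanDist, integral_pos_iff_support_of_nonneg (distL2_nonneg _)
    (integrable_distL2_sublevel N ht)]
  refine (continuous_distL2 _).isOpen_support.measure_pos _ ?_
  refine ⟨fun _ => K * t + 1, ?_⟩
  have h1 := le_distL2_sublevel N hK0 hK ht fun _ => K * t + 1
  have h2 : K * t + 1 ≤ l2norm (fun _ : Fin n => K * t + 1) := by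
    refine Real.le_sqrt_of_sq_le ?_
    exact Finset.single_le_sum (f := fun _ : Fin n => (K * t + 1) ^ 2)
      (fun _ _ => sq_nonneg _) (Finset.mem_univ (0 : Fin n))
  rw [Function.mem_support]
  linarith

theorem tendsto_gaussianMeanDist : Tendsto (gaussianMeanDist N) atTop (𝓝 0) := by
  rw [← integral_zero (Fin n → ℝ) ℝ (μ := stdGaussian n)]
  refine tendsto_integral_filter_of_dominated_convergence l2norm
    (Eventually.of_forall fun t => (continuous_distL2 _).aestronglyMeasurable) ?_
    (integrable_l2norm n) (ae_of_all _ fun h => ?_)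
  · filter_upwards [eventually_ge_atTop 0] with t ht
    refine ae_of_all _ fun h => ?_
    rw [Real.norm_of_nonneg (distL2_nonneg _ h)]
    exact distL2_sublevel_le_l2norm N ht h
  · refine tendsto_const_nhds.congr' ?_
    filter_upwards [eventually_ge_atTop (N h)] with t ht
    exact (distL2_sublevel_eq_zero N ht).symm

theorem contDiffOn_gaussianMeanDist : ContDiffOn ℝ (⊤ : ℕ∞) (gaussianMeanDist N) (Ioi 0) := by
  have h1 := contDiffOn_integral_inv_smul_stdGaussian (continuous_distL2 {x | N x ≤ 1})
    (distL2_nonneg _) fun t ht => by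
      refine ((integrable_distL2_sublevel N ht.le).const_mul t⁻¹).congr (ae_of_all _ fun h => ?_)
      dsimp only
      rw [distL2_sublevel_eq_mul N ht h, inv_mul_cancel_left₀ ht.ne']
  refine (contDiffOn_id.mul h1).congr fun t ht => ?_
  simp only [gaussianMeanDist, id]
  rw [← integral_const_mul]
  exact integral_congr_ae (ae_of_all _ fun h => distL2_sublevel_eq_mul N ht h)

/-- The `ℓ^q` norm as a seminorm on `Fin n → ℝ`. -/
noncomputable def lqSeminorm (n : ℕ) (q : ℝ≥0∞) [Fact (1 ≤ q)] : Seminorm ℝ (Fin n → ℝ) :=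
  (normSeminorm ℝ (PiLp q fun _ : Fin n => ℝ)).comp
    (WithLp.linearEquiv q ℝ (Fin n → ℝ)).symm.toLinearMap

theorem lqSeminorm_apply (q : ℝ≥0∞) [Fact (1 ≤ q)] (x : Fin n → ℝ) :
    lqSeminorm n q x = ‖(WithLp.toLp q x : PiLp q fun _ : Fin n => ℝ)‖ := rfl

theorem lqNorm_eq_lqSeminorm (q : ℝ≥0∞) [hq : Fact (1 ≤ q)] (x : Fin n → ℝ) :
    lqNorm q x = lqSeminorm n q x := by
  rw [lqSeminorm_apply, lqNorm]
  split_ifs with h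
  · subst h
    simp [PiLp.norm_eq_ciSup]
  · rw [PiLp.norm_eq_sum (ENNReal.toReal_pos (zero_lt_one.trans_le hq.out).ne' h)]
    simp

theorem l2norm_le_mul_lqSeminorm (q : ℝ≥0∞) [Fact (1 ≤ q)] (x : Fin n → ℝ) :
    l2norm x ≤ n * lqSeminorm n q x := by
  refine (l2norm_le_sum_abs x).trans ?_
  rw [lqSeminorm_apply]
  calc ∑ i, |x i| ≤ ∑ _i : Fin n, ‖(WithLp.toLp q x : PiLp q fun _ : Fin n => ℝ)‖ :=
        Finset.sum_le_sum fun i _ =>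
          PiLp.norm_apply_le (WithLp.toLp q x : PiLp q fun _ : Fin n => ℝ) i
    _ = _ := by simp

theorem Dp_eq_mul_gaussianMeanDist_sq (q : ℝ≥0∞) [Fact (1 ≤ q)] (t : ℝ) :
    Dp q n t = 1 / n * gaussianMeanDist (lqSeminorm n q) t ^ 2 := by
  simp only [Dp, gaussianMeanDist, lqNorm_eq_lqSeminorm]
end

/-- For `n ≥ 1` and `1 ≤ p ≤ ∞` with conjugate exponent `q = p*`, the
function `D_p` is infinitely differentiable on `(0, ∞)`; moreover, with
`g(t) = D_p(t) − (t/2) D_p'(t)`, for any `0 < δ < D_p(0)` there exists a unique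
`t* ∈ (0, ∞)` such that `g > δ` before `t*` and `g < δ` after `t*`; it satisfies
`g(t*) = δ` and `D_p(t*) < δ`. -/
theorem Dp_smooth_and_threshold (n : ℕ) (hn : 1 ≤ n)
    (p q : ℝ≥0∞) (hp : 1 ≤ p) (hpq : 1 / p + 1 / q = 1) :
    ContDiffOn ℝ (⊤ : ℕ∞) (Dp q n) (Set.Ioi 0) ∧
    ∀ δ : ℝ, 0 < δ → δ < Dp q n 0 →
      ∃ tstar : ℝ, 0 < tstar ∧
        (∀ t : ℝ, 0 < t → t < tstar →
          δ < Dp q n t - (t / 2) * deriv (Dp q n) t) ∧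
        (∀ t : ℝ, tstar < t →
          Dp q n t - (t / 2) * deriv (Dp q n) t < δ) ∧
        Dp q n tstar - (tstar / 2) * deriv (Dp q n) tstar = δ ∧
        Dp q n tstar < δ ∧
        (∀ s : ℝ, 0 < s →
          (∀ t : ℝ, 0 < t → t < s → δ < Dp q n t - (t / 2) * deriv (Dp q n) t) →
          (∀ t : ℝ, s < t → Dp q n t - (t / 2) * deriv (Dp q n) t < δ) →
          s = tstar) := by
  have hq : Fact (1 ≤ q) := by
    refine ⟨?_⟩
    have h : 1 / q ≤ 1 := le_add_self.trans_eq hpq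
    simpa using h
  have : NeZero n := ⟨by omega⟩
  have hK : ∀ x, l2norm x ≤ n * lqSeminorm n q x := l2norm_le_mul_lqSeminorm q
  have hn0 : (0 : ℝ) ≤ n := n.cast_nonneg
  have hD := Dp_eq_mul_gaussianMeanDist_sq (n := n) q
  have hsm := contDiffOn_gaussianMeanDist (lqSeminorm n q)
  refine ⟨?_, fun δ hδ hδ0 => ?_⟩
  · rw [funext hD]
    exact contDiffOn_const.mul (hsm.pow 2)
  · exact exists_threshold_of_convexOn (by positivity) (convexOn_gaussianMeanDist _)
      (fun t ht => gaussianMeanDist_pos _ hn0 hK ht) (tendsto_gaussianMeanDist _)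
      (fun t ht => gaussianMeanDist_zero_sub_le _ hn0 hK ht) hsm hD hδ hδ0
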